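/- There exist unique ℂ-linear maps ∂_0, ∂_+, ∂_- : E_q(2) → E_q(2) satisfying the twisted Leibniz rules ∂_0(ab) = ∂_0(a)σ_0(b) + a∂_0(b) and ∂_±(ab) = ∂_±(a)σ_±(b) + a∂_±(b) and taking on generators the values ∂_0(v) = v, ∂_0(n) = −q²n, ∂_0(n*) = n*, ∂_0(v*) = −q²v*, ∂_+(v) = ∂_+(n) = ∂_+(v*) = 0, ∂_+(n*) = q²v*, ∂_-(v) = ∂_-(n*) = ∂_-(v*) = 0, ∂_-(n) = v. Moreover these are q_i-skew derivations with constants 1, q^{-2}, q² respectively: σ_0^{-1}∘∂_0∘σ_0 = ∂_0, σ_+^{-1}∘∂_+∘σ_+ = q^{-2}∂_+, σ_-^{-1}∘∂_-∘σ_- = q²∂_-; and for homogeneous a, ∂_0(a) is homogeneous of degree |a|, ∂_+(a) of degree |a| − 2, and ∂_-(a) of degree |a| + 2 (whenever nonzero). -/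

import Mathlib

section TwistedDerivation

variable {R A : Type*} [Field R] [Ring A] [Algebra R A]

/-- A twisted derivation kills the unit. -/
theorem twistedDerivation_one (σ : A ≃ₐ[R] A) (D : A →ₗ[R] A)
    (hD : ∀ a c, D (a * c) = D a * σ c + a * D c) : D 1 = 0 := by
  simpa using hD 1 1

/-- Two twisted derivations that agree on a generating set are equal. -/
theorem twistedDerivation_ext (σ : A ≃ₐ[R] A) {s : Set A} (hs : Algebra.adjoin R s = ⊤)
    (D E : A →ₗ[R] A)
    (hD : ∀ a c, D (a * c) = D a * σ c + a * D c)
    (hE : ∀ a c, E (a * c) = E a * σ c + a * E c)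
    (h : ∀ x ∈ s, D x = E x) : D = E := by
  ext a
  have ha : a ∈ Algebra.adjoin R s := hs ▸ Algebra.mem_top
  induction ha using Algebra.adjoin_induction with
  | mem x hx => exact h x hx
  | algebraMap r =>
    simp [Algebra.algebraMap_eq_smul_one, twistedDerivation_one σ D hD,
      twistedDerivation_one σ E hE]
  | add x y _ _ hx hy => simp [hx, hy]
  | mul x y _ _ hx hy => rw [hD, hE, hx, hy]

/-- A twisted derivation which raises the degree of homogeneous generators by `d` raises the
degree of every homogeneous element by `d`. -/
theorem twistedDerivation_mem_graded (𝒜 : ℤ → Submodule R A) [GradedAlgebra 𝒜] (r : R)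
    (σ : A ≃ₐ[R] A) (hσ : ∀ (k : ℤ) (a : A), a ∈ 𝒜 k → σ a = r ^ k • a)
    {s : Set A} (hs : Algebra.adjoin R s = ⊤) (D : A →ₗ[R] A)
    (hD : ∀ a c, D (a * c) = D a * σ c + a * D c) (d : ℤ)
    (h : ∀ x ∈ s, ∃ k, x ∈ 𝒜 k ∧ D x ∈ 𝒜 (k + d)) (k : ℤ) (a : A) (ha : a ∈ 𝒜 k) :
    D a ∈ 𝒜 (k + d) := by
  have hmon : ∀ x ∈ Submonoid.closure s, ∃ k, x ∈ 𝒜 k ∧ D x ∈ 𝒜 (k + d) := by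
    intro x hx
    induction hx using Submonoid.closure_induction with
    | mem x hx => exact h x hx
    | one =>
      refine ⟨0, SetLike.one_mem_graded 𝒜, ?_⟩
      rw [twistedDerivation_one σ D hD]
      exact zero_mem _
    | mul x y _ _ hx hy =>
      obtain ⟨i, hxi, hDx⟩ := hx
      obtain ⟨j, hyj, hDy⟩ := hy
      refine ⟨i + j, SetLike.mul_mem_graded hxi hyj, ?_⟩
      rw [hD, hσ j y hyj]
      refine add_mem ?_ ?_
      · have := SetLike.mul_mem_graded hDx ((𝒜 j).smul_mem (r ^ j) hyj)
        rwa [add_right_comm] at this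
      · have := SetLike.mul_mem_graded hxi hDy
        rwa [← add_assoc] at this
  have hproj : ∀ b ∈ Submodule.span R (Submonoid.closure s : Set A),
      D (DirectSum.decompose 𝒜 b k) ∈ 𝒜 (k + d) := by
    intro b hb
    induction hb using Submodule.span_induction with
    | mem x hx =>
      obtain ⟨j, hxj, hDx⟩ := hmon x hx
      by_cases hjk : j = k
      · subst hjk
        rwa [DirectSum.decompose_of_mem_same 𝒜 hxj]
      · rw [DirectSum.decompose_of_mem_ne 𝒜 hxj hjk, map_zero]
        exact zero_mem _
    | zero => simp
    | add x y _ _ hx hy => simpa using add_mem hx hy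
    | smul t x _ hx =>
      rw [DirectSum.decompose_smul, DirectSum.smul_apply, Submodule.coe_smul, map_smul]
      exact (𝒜 (k + d)).smul_mem t hx
  have hmem : a ∈ Submodule.span R (Submonoid.closure s : Set A) := by
    rw [← Algebra.adjoin_eq_span, hs]
    exact Submodule.mem_top
  simpa [DirectSum.decompose_of_mem_same 𝒜 ha] using hproj a hmem

/-- If `σ` acts on degree `k` by `r ^ k` and `D` raises degrees by `d`, then `D` is skew with
constant `r ^ (-d)`. -/
theorem symm_comp_comp_eq_smul (𝒜 : ℤ → Submodule R A) [GradedAlgebra 𝒜] {r : R} (hr : r ≠ 0)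
    (σ : A ≃ₐ[R] A) (hσ : ∀ (k : ℤ) (a : A), a ∈ 𝒜 k → σ a = r ^ k • a)
    (D : A →ₗ[R] A) (d : ℤ) (h : ∀ (k : ℤ) (a : A), a ∈ 𝒜 k → D a ∈ 𝒜 (k + d)) (a : A) :
    σ.symm (D (σ a)) = r ^ (-d) • D a := by
  induction a using DirectSum.Decomposition.inductionOn 𝒜 with
  | zero => simp
  | @homogeneous k a =>
    rw [AlgEquiv.symm_apply_eq, hσ k a a.2, map_smul, map_smul, hσ _ _ (h k a a.2), smul_smul,
      ← zpow_add₀ hr]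
    congr 2
    ring
  | add a b ha hb => simp only [map_add, ha, hb, smul_add]

end TwistedDerivation

/-- The first-row, second-column entry of an algebra map into `2 × 2` matrices which sends
generators `x` to matrices of the form `!![x, y; 0, σ x]` is a twisted derivation. -/
theorem exists_twistedDerivation_of_matrix {R A : Type*} [Field R] [Ring A] [Algebra R A]
    (σ : A ≃ₐ[R] A) {s : Set A} (hs : Algebra.adjoin R s = ⊤)
    (f : A →ₐ[R] Matrix (Fin 2) (Fin 2) A)
    (hf : ∀ x ∈ s, f x 0 0 = x ∧ f x 1 0 = 0 ∧ f x 1 1 = σ x) :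
    ∃ D : A →ₗ[R] A, (∀ a c, D (a * c) = D a * σ c + a * D c) ∧ ∀ a, D a = f a 0 1 := by
  have key : ∀ a, f a 0 0 = a ∧ f a 1 0 = 0 ∧ f a 1 1 = σ a := by
    intro a
    have ha : a ∈ Algebra.adjoin R s := hs ▸ Algebra.mem_top
    induction ha using Algebra.adjoin_induction with
    | mem x hx => exact hf x hx
    | algebraMap r => simp [Matrix.algebraMap_matrix_apply]
    | add x y _ _ hx hy => simp [hx, hy]
    | mul x y _ _ hx hy => simp [Matrix.mul_apply, Fin.sum_univ_two, hx, hy]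
  refine ⟨{ toFun := fun a => f a 0 1, map_add' := ?_, map_smul' := ?_ }, ?_, fun _ => rfl⟩
  · intro a c
    simp
  · intro t a
    simp
  · intro a c
    simp [Matrix.mul_apply, Fin.sum_univ_two, (key a).1, (key c).2.2, add_comm]

/-- On an algebra with the universal property of `E_q(2)`, values on the generators compatible with
the defining relations extend to a twisted derivation. -/
theorem exists_twistedDerivation (q : ℂ) (A : Type) [Ring A] [Algebra ℂ A] (v vs n ns : A)
    (hnns : n * ns = ns * n) (hvvs : v * vs = 1) (hvsv : vs * v = 1)
    (hvn : v * n = q • (n * v)) (hvns : v * ns = q • (ns * v))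
    (hgen : Algebra.adjoin ℂ {v, vs, n, ns} = ⊤)
    (hUP : ∀ (B : Type) [Ring B] [Algebra ℂ B] (v' vs' n' ns' : B),
      n' * ns' = ns' * n' → v' * vs' = 1 → vs' * v' = 1 →
      v' * n' = q • (n' * v') → v' * ns' = q • (ns' * v') →
      ∃ f : A →ₐ[ℂ] B, f v = v' ∧ f vs = vs' ∧ f n = n' ∧ f ns = ns')
    (σ : A ≃ₐ[ℂ] A) (dv dvs dn dns : A)
    (h₁ : dn * σ ns + n * dns = dns * σ n + ns * dn)
    (h₂ : dv * σ vs + v * dvs = 0) (h₃ : dvs * σ v + vs * dv = 0)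
    (h₄ : dv * σ n + v * dn = q • (dn * σ v + n * dv))
    (h₅ : dv * σ ns + v * dns = q • (dns * σ v + ns * dv)) :
    ∃ D : A →ₗ[ℂ] A, (∀ a c, D (a * c) = D a * σ c + a * D c) ∧
      D v = dv ∧ D vs = dvs ∧ D n = dn ∧ D ns = dns := by
  obtain ⟨f, hv, hvs, hn, hns⟩ := hUP (Matrix (Fin 2) (Fin 2) A)
    !![v, dv; 0, σ v] !![vs, dvs; 0, σ vs] !![n, dn; 0, σ n] !![ns, dns; 0, σ ns]
    (by simp [← map_mul, hnns, add_comm (n * dns), add_comm (ns * dn), h₁])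
    (by simp [← map_mul, hvvs, add_comm (v * dvs), h₂, Matrix.one_fin_two])
    (by simp [← map_mul, hvsv, add_comm (vs * dv), h₃, Matrix.one_fin_two])
    (by
      rw [Matrix.mul_fin_two, Matrix.mul_fin_two]
      simp [← map_mul, hvn, add_comm (v * dn), h₄, add_comm (n * dv), smul_add])
    (by
      rw [Matrix.mul_fin_two, Matrix.mul_fin_two]
      simp [← map_mul, hvns, add_comm (v * dns), h₅, add_comm (ns * dv), smul_add])
  obtain ⟨D, hD, hDf⟩ := exists_twistedDerivation_of_matrix σ hgen f (by
    rintro x (rfl | rfl | rfl | rfl) <;> simp [*])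
  exact ⟨D, hD, by simp [hDf, hv], by simp [hDf, hvs], by simp [hDf, hn], by simp [hDf, hns]⟩


/-- On `E_q(2)` there exist unique ℂ-linear maps `∂_0, ∂_+, ∂_-`
satisfying the `σ_i`-twisted Leibniz rules and the prescribed values on the
generators; moreover they are `q_i`-skew derivations with constants `1, q⁻², q²`,
and they shift ℤ-degrees by `0, -2, +2` respectively. -/
theorem statement3
    (q : ℝ) (hq : q ≠ 0)
    (A : Type) [Ring A] [Algebra ℂ A]
    (v vs n ns : A)
    (hnns : n * ns = ns * n)
    (hvvs : v * vs = 1) (hvsv : vs * v = 1)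
    (hvn : v * n = (q : ℂ) • (n * v))
    (hvns : v * ns = (q : ℂ) • (ns * v))
    (hgen : Algebra.adjoin ℂ {v, vs, n, ns} = ⊤)
    (hUP : ∀ (B : Type) [Ring B] [Algebra ℂ B] (v' vs' n' ns' : B),
      n' * ns' = ns' * n' → v' * vs' = 1 → vs' * v' = 1 →
      v' * n' = (q : ℂ) • (n' * v') → v' * ns' = (q : ℂ) • (ns' * v') →
      ∃ f : A →ₐ[ℂ] B, f v = v' ∧ f vs = vs' ∧ f n = n' ∧ f ns = ns')
    -- the ℤ-grading, |v| = |n*| = 1, |v*| = |n| = -1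
    (𝒜 : ℤ → Submodule ℂ A) [GradedAlgebra 𝒜]
    (hv1 : v ∈ 𝒜 1) (hns1 : ns ∈ 𝒜 1) (hvs1 : vs ∈ 𝒜 (-1)) (hn1 : n ∈ 𝒜 (-1))
    -- the automorphisms σ_0(a) = q^{-2|a|} a, σ_±(a) = q^{-|a|} a
    (σ0 σp σm : A ≃ₐ[ℂ] A)
    (hσ0 : ∀ (k : ℤ) (a : A), a ∈ 𝒜 k → σ0 a = ((q:ℂ) ^ (-2 * k : ℤ)) • a)
    (hσp : ∀ (k : ℤ) (a : A), a ∈ 𝒜 k → σp a = ((q:ℂ) ^ (-k : ℤ)) • a)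
    (hσm : ∀ (k : ℤ) (a : A), a ∈ 𝒜 k → σm a = ((q:ℂ) ^ (-k : ℤ)) • a) :
    -- existence and uniqueness of the twisted derivations ∂_0, ∂_+, ∂_- …
    (∃! D : (A →ₗ[ℂ] A) × (A →ₗ[ℂ] A) × (A →ₗ[ℂ] A),
      (∀ a c, D.1 (a * c) = D.1 a * σ0 c + a * D.1 c) ∧
      (∀ a c, D.2.1 (a * c) = D.2.1 a * σp c + a * D.2.1 c) ∧
      (∀ a c, D.2.2 (a * c) = D.2.2 a * σm c + a * D.2.2 c) ∧
      D.1 v = v ∧ D.1 n = (-(q:ℂ)^2) • n ∧ D.1 ns = ns ∧ D.1 vs = (-(q:ℂ)^2) • vs ∧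
      D.2.1 v = 0 ∧ D.2.1 n = 0 ∧ D.2.1 ns = (q:ℂ)^2 • vs ∧ D.2.1 vs = 0 ∧
      D.2.2 v = 0 ∧ D.2.2 n = v ∧ D.2.2 ns = 0 ∧ D.2.2 vs = 0)
    -- … and these maps are q_i-skew derivations with constants 1, q⁻², q²,
    -- and shift ℤ-degrees by 0, -2, +2 respectively:
    ∧ (∀ p0 pp pm : A →ₗ[ℂ] A,
        (∀ a c, p0 (a * c) = p0 a * σ0 c + a * p0 c) →
        (∀ a c, pp (a * c) = pp a * σp c + a * pp c) →
        (∀ a c, pm (a * c) = pm a * σm c + a * pm c) →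
        p0 v = v → p0 n = (-(q:ℂ)^2) • n → p0 ns = ns → p0 vs = (-(q:ℂ)^2) • vs →
        pp v = 0 → pp n = 0 → pp ns = (q:ℂ)^2 • vs → pp vs = 0 →
        pm v = 0 → pm n = v → pm ns = 0 → pm vs = 0 →
        ((∀ a, σ0.symm (p0 (σ0 a)) = p0 a) ∧
         (∀ a, σp.symm (pp (σp a)) = ((q:ℂ)^2)⁻¹ • pp a) ∧
         (∀ a, σm.symm (pm (σm a)) = (q:ℂ)^2 • pm a) ∧
         (∀ (k : ℤ) (a : A), a ∈ 𝒜 k → p0 a ∈ 𝒜 k) ∧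
         (∀ (k : ℤ) (a : A), a ∈ 𝒜 k → pp a ∈ 𝒜 (k - 2)) ∧
         (∀ (k : ℤ) (a : A), a ∈ 𝒜 k → pm a ∈ 𝒜 (k + 2)))) := by
  have hq' : (q : ℂ) ≠ 0 := by exact_mod_cast hq
  have hr0 : ∀ (k : ℤ) (a : A), a ∈ 𝒜 k → σ0 a = (((q : ℂ) ^ 2)⁻¹) ^ k • a := by
    intro k a ha
    rw [hσ0 k a ha, zpow_mul]
    norm_cast
  have hrp : ∀ (k : ℤ) (a : A), a ∈ 𝒜 k → σp a = ((q : ℂ)⁻¹) ^ k • a := by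
    intro k a ha
    rw [hσp k a ha, inv_zpow']
  have hrm : ∀ (k : ℤ) (a : A), a ∈ 𝒜 k → σm a = ((q : ℂ)⁻¹) ^ k • a := by
    intro k a ha
    rw [hσm k a ha, inv_zpow']
  have hnvs : n * vs = (q : ℂ) • (vs * n) := by
    calc n * vs = vs * (v * n) * vs := by rw [← mul_assoc, hvsv, one_mul]
      _ = (q : ℂ) • (vs * n * (v * vs)) := by
        rw [hvn]
        simp only [mul_smul_comm, smul_mul_assoc, mul_assoc]
      _ = (q : ℂ) • (vs * n) := by rw [hvvs, mul_one]
  have s0v := hr0 _ _ hv1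
  have s0vs := hr0 _ _ hvs1
  have s0n := hr0 _ _ hn1
  have s0ns := hr0 _ _ hns1
  have spv := hrp _ _ hv1
  have spn := hrp _ _ hn1
  have smv := hrm _ _ hv1
  have smns := hrm _ _ hns1
  simp only [zpow_neg, zpow_one, inv_inv] at s0v s0vs s0n s0ns spv spn smv smns
  obtain ⟨D0, hD0, h0v, h0vs, h0n, h0ns⟩ := exists_twistedDerivation q A v vs n ns hnns hvvs hvsv
    hvn hvns hgen hUP σ0 v (-(q : ℂ) ^ 2 • vs) (-(q : ℂ) ^ 2 • n) ns
    (by simp [s0ns, s0n, hnns, smul_smul, hq'])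
    (by simp [s0vs, hvvs])
    (by simp [s0v, hvsv, smul_smul, hq'])
    (by simp [s0v, s0n, smul_smul, hq'])
    (by simp [-Complex.coe_smul, s0v, s0ns, hvns, smul_smul, smul_add, mul_comm])
  obtain ⟨Dp, hDp, hpv, hpvs, hpn, hpns⟩ := exists_twistedDerivation q A v vs n ns hnns hvvs hvsv
    hvn hvns hgen hUP σp 0 0 0 ((q : ℂ) ^ 2 • vs)
    (by simp [-Complex.coe_smul, spn, hnvs, smul_smul, mul_comm])
    (by simp) (by simp) (by simp)
    (by
      simp only [spv, zero_mul, zero_add, mul_smul_comm, smul_mul_assoc, hvvs, hvsv, mul_zero,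
        add_zero, smul_smul]
      congr 1
      field_simp)
  obtain ⟨Dm, hDm, hmv, hmvs, hmn, hmns⟩ := exists_twistedDerivation q A v vs n ns hnns hvvs hvsv
    hvn hvns hgen hUP σm 0 0 v 0
    (by simp [-Complex.coe_smul, smns, hvns, smul_smul, hq'])
    (by simp) (by simp)
    (by simp [smv, smul_smul, hq'])
    (by simp)
  refine ⟨⟨(D0, Dp, Dm), ⟨hD0, hDp, hDm, h0v, h0n, h0ns, h0vs, hpv, hpn, hpns, hpvs, hmv, hmn,
    hmns, hmvs⟩, ?_⟩, ?_⟩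
  · rintro ⟨E0, Ep, Em⟩ ⟨hE0, hEp, hEm, e0v, e0n, e0ns, e0vs, epv, epn, epns, epvs, emv, emn,
      emns, emvs⟩
    dsimp only at *
    refine Prod.ext ?_ (Prod.ext ?_ ?_)
    · refine twistedDerivation_ext σ0 hgen _ _ hE0 hD0 ?_
      rintro x (rfl | rfl | rfl | rfl)
      exacts [e0v.trans h0v.symm, e0vs.trans h0vs.symm, e0n.trans h0n.symm, e0ns.trans h0ns.symm]
    · refine twistedDerivation_ext σp hgen _ _ hEp hDp ?_
      rintro x (rfl | rfl | rfl | rfl)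
      exacts [epv.trans hpv.symm, epvs.trans hpvs.symm, epn.trans hpn.symm, epns.trans hpns.symm]
    · refine twistedDerivation_ext σm hgen _ _ hEm hDm ?_
      rintro x (rfl | rfl | rfl | rfl)
      exacts [emv.trans hmv.symm, emvs.trans hmvs.symm, emn.trans hmn.symm, emns.trans hmns.symm]
  · intro p0 pp pm hp0 hpp hpm e0v e0n e0ns e0vs epv epn epns epvs emv emn emns emvs
    have g0 : ∀ (k : ℤ) (a : A), a ∈ 𝒜 k → p0 a ∈ 𝒜 (k + 0) := by
      refine twistedDerivation_mem_graded 𝒜 _ σ0 hr0 hgen p0 hp0 0 ?_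
      rintro x (rfl | rfl | rfl | rfl)
      · exact ⟨1, hv1, by rwa [e0v]⟩
      · exact ⟨-1, hvs1, by rw [e0vs]; exact Submodule.smul_mem _ _ hvs1⟩
      · exact ⟨-1, hn1, by rw [e0n]; exact Submodule.smul_mem _ _ hn1⟩
      · exact ⟨1, hns1, by rwa [e0ns]⟩
    have gp : ∀ (k : ℤ) (a : A), a ∈ 𝒜 k → pp a ∈ 𝒜 (k + -2) := by
      refine twistedDerivation_mem_graded 𝒜 _ σp hrp hgen pp hpp (-2) ?_
      rintro x (rfl | rfl | rfl | rfl)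
      · exact ⟨1, hv1, by rw [epv]; exact zero_mem _⟩
      · exact ⟨-1, hvs1, by rw [epvs]; exact zero_mem _⟩
      · exact ⟨-1, hn1, by rw [epn]; exact zero_mem _⟩
      · exact ⟨1, hns1, by rw [epns]; exact Submodule.smul_mem _ _ hvs1⟩
    have gm : ∀ (k : ℤ) (a : A), a ∈ 𝒜 k → pm a ∈ 𝒜 (k + 2) := by
      refine twistedDerivation_mem_graded 𝒜 _ σm hrm hgen pm hpm 2 ?_
      rintro x (rfl | rfl | rfl | rfl)
      · exact ⟨1, hv1, by rw [emv]; exact zero_mem _⟩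
      · exact ⟨-1, hvs1, by rw [emvs]; exact zero_mem _⟩
      · exact ⟨-1, hn1, by rw [emn]; exact hv1⟩
      · exact ⟨1, hns1, by rw [emns]; exact zero_mem _⟩
    refine ⟨fun a => ?_, fun a => ?_, fun a => ?_, fun k a ha => ?_, gp, gm⟩
    · rw [symm_comp_comp_eq_smul 𝒜 (inv_ne_zero (pow_ne_zero 2 hq')) σ0 hr0 p0 0 g0 a]
      simp
    · rw [symm_comp_comp_eq_smul 𝒜 (inv_ne_zero hq') σp hrp pp (-2) gp a, neg_neg, inv_zpow]
      norm_cast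
    · rw [symm_comp_comp_eq_smul 𝒜 (inv_ne_zero hq') σm hrm pm 2 gm a, inv_zpow', neg_neg]
      norm_cast
    · simpa using g0 k a ha
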